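/- Let d ≥ 1 be an integer and let L, β, α be positive constants. Then there exists a constant C > 0 such that for every n ≥ 1 and every classifier f̂_n: 𝒵^n → ℱ, sup_{P∈𝒫'_Σ} {E[R(f̂_n)] − R(f*)} ≥ C n^{−(1+α)β/((2+α)β+d)}. -/

import Mathlib

open MeasureTheory ENNReal Matrix
open scoped Classical

noncomputable section

abbrev Euc (d : ℕ) := EuclideanSpace ℝ (Fin d)

/-- Margin (low noise) assumption (MA) with parameters `α`, `C₀`:
`P_X(0 < |η(X) − 1/2| ≤ t) ≤ C₀ t^α` for all `t > 0`. -/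
def margin (d : ℕ) (α C₀ : ℝ) (PX : Measure (Euc d)) (η : Euc d → ℝ) : Prop :=
  ∀ t : ℝ, 0 < t →
    PX {x | 0 < |η x - 1/2| ∧ |η x - 1/2| ≤ t} ≤ ENNReal.ofReal (C₀ * t ^ α)

/-- The plug-in rule `1{η ≥ 1/2}`; applied to the true regression function this is
the Bayes rule `f*`. -/
def plugin (d : ℕ) (η : Euc d → ℝ) : Euc d → Bool :=
  fun x => if 1/2 ≤ η x then true else false

/-- Excess risk `R(f) − R(f*) = E[|2η(X)−1| 1{f(X) ≠ f*(X)}]`. -/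
def excessRisk (d : ℕ) (PX : Measure (Euc d)) (η : Euc d → ℝ) (f : Euc d → Bool) : ℝ :=
  ∫ x, (if f x = plugin d η x then 0 else |2 * η x - 1|) ∂PX

/-- Joint distribution `P` of `(X,Y)` on `ℝ^d × ℝ` (with `Y ∈ {0,1}`) determined by the
marginal `PX` of `X` and the regression function `η(x) = P(Y = 1 | X = x)`. -/
def joint (d : ℕ) (PX : Measure (Euc d)) (η : Euc d → ℝ) : Measure (Euc d × ℝ) :=
  PX.bind fun x =>
    ENNReal.ofReal (η x) • Measure.dirac (x, (1:ℝ)) +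
      ENNReal.ofReal (1 - η x) • Measure.dirac (x, (0:ℝ))

/-- Law `P^⊗n` of the i.i.d. sample `(X₁,Y₁),…,(Xₙ,Yₙ)`. -/
def sampleLaw (d n : ℕ) (PX : Measure (Euc d)) (η : Euc d → ℝ) :
    Measure (Fin n → Euc d × ℝ) :=
  Measure.pi fun _ => joint d PX η

/-- Expected excess risk `E[R(f̂ₙ)] − R(f*)` of a classifier `f̂ₙ`. -/
def expectedExcess (d n : ℕ) (PX : Measure (Euc d)) (η : Euc d → ℝ)
    (fhat : (Fin n → Euc d × ℝ) → Euc d → Bool) : ℝ :=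
  ∫ D, excessRisk d PX η (fhat D) ∂(sampleLaw d n PX η)

/-- Multivariate Taylor polynomial of degree `k` of `g` at `x`, evaluated at `x'`. -/
def taylorPoly (d : ℕ) (k : ℕ) (g : Euc d → ℝ) (x x' : Euc d) : ℝ :=
  ∑ j ∈ Finset.range (k + 1),
    ((j.factorial : ℝ))⁻¹ * iteratedFDeriv ℝ j g x (fun _ => x' - x)

/-- The Hölder class `Σ(β, L, ℝ^d)`: `⌊β⌋ = ⌈β⌉₊ - 1` times continuously differentiable
functions whose Taylor polynomial of degree `⌊β⌋` approximates them to order `‖x' - x‖^β`. -/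
def holderClass (d : ℕ) (β L : ℝ) : Set (Euc d → ℝ) :=
  {g | ContDiff ℝ (⌈β⌉₊ - 1 : ℕ) g ∧
    ∀ x x' : Euc d, |g x' - taylorPoly d (⌈β⌉₊ - 1) g x x'| ≤ L * ‖x' - x‖ ^ β}

/-- `(c₀, r₀)`-regularity of a set `A`:
`λ[A ∩ B(x,r)] ≥ c₀ λ[B(x,r)]` for all `0 < r ≤ r₀`, `x ∈ A`. -/
def regularSet (d : ℕ) (c₀ r₀ : ℝ) (A : Set (Euc d)) : Prop :=
  ∀ x ∈ A, ∀ r : ℝ, 0 < r → r ≤ r₀ →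
    ENNReal.ofReal c₀ * volume (Metric.closedBall x r) ≤ volume (A ∩ Metric.closedBall x r)

/-- Strong density assumption: `P_X` is supported on a compact `(c₀,r₀)`-regular set
`A ⊆ 𝒞` and has a Lebesgue density bounded between `μmin` and `μmax` on `A`, zero outside. -/
def strongDensity (d : ℕ) (c₀ r₀ μmin μmax : ℝ) (𝒞 : Set (Euc d))
    (PX : Measure (Euc d)) : Prop :=
  ∃ A : Set (Euc d), IsCompact A ∧ A ⊆ 𝒞 ∧ regularSet d c₀ r₀ A ∧
    ∃ μf : Euc d → ℝ, (∀ x ∈ A, μmin ≤ μf x ∧ μf x ≤ μmax) ∧ (∀ x ∉ A, μf x = 0) ∧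
      PX = volume.withDensity fun x => ENNReal.ofReal (μf x)

/-- Mild density assumption: `P_X` is supported on a compact `(c₀,r₀)`-regular set
`A ⊆ 𝒞` and has a Lebesgue density bounded above by `μmax` on `A`, zero outside. -/
def mildDensity (d : ℕ) (c₀ r₀ μmax : ℝ) (𝒞 : Set (Euc d))
    (PX : Measure (Euc d)) : Prop :=
  ∃ A : Set (Euc d), IsCompact A ∧ A ⊆ 𝒞 ∧ regularSet d c₀ r₀ A ∧
    ∃ μf : Euc d → ℝ, (∀ x ∈ A, 0 ≤ μf x ∧ μf x ≤ μmax) ∧ (∀ x ∉ A, μf x = 0) ∧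
      PX = volume.withDensity fun x => ENNReal.ofReal (μf x)

open scoped ContDiff

theorem iteratedDeriv_comp_line {d k j : ℕ} {f : Euc d → ℝ} (hf : ContDiff ℝ k f) (hj : j ≤ k)
    (x v : Euc d) (t : ℝ) :
    iteratedDeriv j (fun s : ℝ => f (x + s • v)) t =
      iteratedFDeriv ℝ j f (x + t • v) fun _ => v := by
  have hg : ContDiff ℝ k (fun z => f (x + z)) := hf.comp (contDiff_const.add contDiff_id)
  have h := (ContinuousLinearMap.toSpanSingleton ℝ v).iteratedFDeriv_comp_right hg t
    (i := j) (by exact_mod_cast hj)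
  rw [iteratedDeriv_eq_iteratedFDeriv]
  change iteratedFDeriv ℝ j ((fun z => f (x + z)) ∘ ContinuousLinearMap.toSpanSingleton ℝ v) t _ = _
  rw [h, iteratedFDeriv_comp_add_left]
  simp

theorem abs_sub_taylorPoly_le {d k : ℕ} {f : Euc d → ℝ} (hf : ContDiff ℝ (k + 1 : ℕ) f) {D : ℝ}
    (hD : ∀ z, ‖iteratedFDeriv ℝ (k + 1) f z‖ ≤ D) (x x' : Euc d) :
    |f x' - taylorPoly d k f x x'| ≤ D * ‖x' - x‖ ^ (k + 1) := by
  set v := x' - x with hv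
  have hline : ContDiff ℝ (k + 1 : ℕ) (fun s : ℝ => f (x + s • v)) :=
    hf.comp (contDiff_const.add (contDiff_id.smul contDiff_const))
  obtain ⟨ξ, -, hξ⟩ := taylor_mean_remainder_lagrange_iteratedDeriv
    (f := fun s : ℝ => f (x + s • v)) (x := 1) (x₀ := 0) (n := k) zero_ne_one
    (by exact_mod_cast hline.contDiffOn)
  have hT : taylorWithinEval (fun s : ℝ => f (x + s • v)) k (Set.uIcc 0 1) 0 1
      = taylorPoly d k f x x' := by
    rw [taylor_within_apply, taylorPoly]
    refine Finset.sum_congr rfl fun j hj => ?_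
    have hjk : j ≤ k + 1 := (Finset.mem_range.1 hj).le
    rw [iteratedDerivWithin_eq_iteratedDeriv (uniqueDiffOn_uIcc zero_ne_one)
      ((hline.of_le (by exact_mod_cast hjk)).contDiffAt) Set.left_mem_uIcc,
      iteratedDeriv_comp_line hf hjk]
    simp [hv]
  have hone : f (x + (1 : ℝ) • v) = f x' := by simp [hv]
  rw [hT, hone, iteratedDeriv_comp_line hf le_rfl] at hξ
  rw [hξ, sub_zero, one_pow, mul_one, abs_div]
  have hfac : (1 : ℝ) ≤ |((k + 1).factorial : ℝ)| := by
    rw [Nat.abs_cast]; exact_mod_cast Nat.succ_le_of_lt (Nat.factorial_pos _)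
  refine (div_le_self (abs_nonneg _) hfac).trans ?_
  refine ((iteratedFDeriv ℝ (k + 1) f (x + ξ • v)).le_opNorm _).trans ?_
  simp only [Finset.prod_const, Finset.card_univ, Fintype.card_fin]
  exact mul_le_mul_of_nonneg_right (hD _) (by positivity)

theorem abs_taylorPoly_le {d k : ℕ} {f : Euc d → ℝ} {D : ℝ}
    (hD : ∀ j ≤ k, ∀ z, ‖iteratedFDeriv ℝ j f z‖ ≤ D) {x x' : Euc d} (h : 1 ≤ ‖x' - x‖) :
    |taylorPoly d k f x x'| ≤ (k + 1) * (D * ‖x' - x‖ ^ k) := by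
  have hD0 : 0 ≤ D := (norm_nonneg _).trans (hD 0 (Nat.zero_le _) x)
  refine (Finset.abs_sum_le_sum_abs _ _).trans ?_
  refine (Finset.sum_le_card_nsmul _ _ (D * ‖x' - x‖ ^ k) fun j hj => ?_).trans (by simp)
  have hjk : j ≤ k := Nat.lt_succ_iff.1 (Finset.mem_range.1 hj)
  have hfac : |((j.factorial : ℝ))⁻¹| ≤ 1 := by
    rw [abs_inv, Nat.abs_cast]
    exact inv_le_one_of_one_le₀ (by exact_mod_cast Nat.succ_le_of_lt (Nat.factorial_pos _))
  rw [abs_mul]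
  refine (mul_le_of_le_one_left (abs_nonneg _) hfac).trans ?_
  refine ((iteratedFDeriv ℝ j f x).le_opNorm _).trans ?_
  simp only [Finset.prod_const, Finset.card_univ, Fintype.card_fin]
  exact mul_le_mul (hD j hjk x) (pow_le_pow_right₀ h hjk) (by positivity) hD0

/-- A smooth compactly supported function belongs to every Hölder class, for some constant. -/
theorem exists_mem_holderClass_of_hasCompactSupport {d : ℕ} {β : ℝ} (hβ : 0 < β) {f : Euc d → ℝ}
    (hf : ContDiff ℝ ∞ f) (hc : HasCompactSupport f) : ∃ M > 0, f ∈ holderClass d β M := by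
  have hbd : ∀ j : ℕ, ∃ D, ∀ z, ‖iteratedFDeriv ℝ j f z‖ ≤ D := fun j =>
    (hf.continuous_iteratedFDeriv (by exact_mod_cast le_top)).bounded_above_of_compact_support
      (hc.iteratedFDeriv j)
  choose D hD using hbd
  have hD0 : ∀ j, 0 ≤ D j := fun j => (norm_nonneg _).trans (hD j 0)
  set k := ⌈β⌉₊ - 1 with hk
  have hceil : ⌈β⌉₊ = k + 1 := by have := Nat.ceil_pos.2 hβ; omega
  have hkβ : (k : ℝ) ≤ β := by
    have := Nat.ceil_lt_add_one hβ.le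
    rw [hceil] at this; push_cast at this; linarith
  have hβk : β ≤ ((k + 1 : ℕ) : ℝ) := hceil ▸ Nat.le_ceil β
  set S := ∑ j ∈ Finset.range (k + 2), D j with hS
  have hSD : ∀ j ≤ k + 1, ∀ z, ‖iteratedFDeriv ℝ j f z‖ ≤ S := fun j hj z =>
    (hD j z).trans (Finset.single_le_sum (fun i _ => hD0 i) (Finset.mem_range.2 (by omega)))
  have hS0 : 0 ≤ S := Finset.sum_nonneg fun i _ => hD0 i
  refine ⟨(k + 2) * S + 1, by positivity, contDiff_infty.1 hf _, fun x x' => ?_⟩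
  rcases le_total ‖x' - x‖ 1 with h | h
  · refine (abs_sub_taylorPoly_le (contDiff_infty.1 hf _) (hSD _ le_rfl) x x').trans ?_
    have hpow : ‖x' - x‖ ^ (k + 1) ≤ ‖x' - x‖ ^ β := by
      rw [← Real.rpow_natCast]
      exact Real.rpow_le_rpow_of_exponent_ge' (norm_nonneg _) h hβ.le hβk
    exact mul_le_mul (by nlinarith [(Nat.cast_nonneg k : (0 : ℝ) ≤ k)]) hpow (by positivity)
      (by positivity)
  · have hpow : ‖x' - x‖ ^ k ≤ ‖x' - x‖ ^ β := by
      rw [← Real.rpow_natCast]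
      exact Real.rpow_le_rpow_of_exponent_le h hkβ
    have hone : (1 : ℝ) ≤ ‖x' - x‖ ^ k := one_le_pow₀ h
    have h1 : |f x'| ≤ S := by
      have := hSD 0 (Nat.zero_le _) x'
      rwa [norm_iteratedFDeriv_zero, Real.norm_eq_abs] at this
    have h2 := abs_taylorPoly_le (k := k) (fun j hj => hSD j (by omega)) h
    calc |f x' - taylorPoly d k f x x'| ≤ |f x'| + |taylorPoly d k f x x'| := abs_sub _ _
      _ ≤ S * ‖x' - x‖ ^ k + (k + 1) * (S * ‖x' - x‖ ^ k) := by nlinarith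
      _ = ((k + 2) * S) * ‖x' - x‖ ^ k := by ring
      _ ≤ ((k + 2) * S + 1) * ‖x' - x‖ ^ β :=
        mul_le_mul (by linarith) hpow (by positivity) (by positivity)

theorem taylorPoly_affine_sum {d k : ℕ} {ι : Type*} [Fintype ι] {f : Euc d → ℝ}
    (hf : ContDiff ℝ k f) (a h q : ℝ) (s : ι → ℝ) (c : ι → Euc d) (x x' : Euc d) :
    taylorPoly d k (fun x => a + h * ∑ i, s i * f (q • x - c i)) x x'
      = a + h * ∑ i, s i * taylorPoly d k f (q • x - c i) (q • x' - c i) := by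
  have hterm : ∀ i, ContDiff ℝ k (fun x => f (q • x - c i)) := fun i =>
    hf.comp ((contDiff_const_smul q).sub contDiff_const)
  have hder : ∀ j ≤ k, iteratedFDeriv ℝ j (fun x => a + h * ∑ i, s i * f (q • x - c i)) x
      (fun _ => x' - x) = (if j = 0 then a else 0) + h * ∑ i, s i *
        iteratedFDeriv ℝ j f (q • x - c i) (fun _ => (q • x' - c i) - (q • x - c i)) := by
    intro j hj
    have hjk : (j : ℕ∞ω) ≤ k := by exact_mod_cast hj
    have hsum : ContDiff ℝ j (fun x => h * ∑ i, s i * f (q • x - c i)) :=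
      contDiff_const.mul (ContDiff.sum fun i _ => contDiff_const.mul ((hterm i).of_le hjk))
    have hline := iteratedDeriv_comp_line (k := j)
      (f := fun x => a + h * ∑ i, s i * f (q • x - c i)) (contDiff_const.add hsum) le_rfl x
      (x' - x) 0
    have hlin : ∀ i, (fun t : ℝ => f (q • (x + t • (x' - x)) - c i)) =
        fun t : ℝ => f ((q • x - c i) + t • ((q • x' - c i) - (q • x - c i))) := by
      intro i; funext t; congr 1; module
    have hcd : ∀ i, ContDiff ℝ j (fun t : ℝ => f (q • (x + t • (x' - x)) - c i)) := fun i =>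
      ((hterm i).of_le hjk).comp (contDiff_const.add (contDiff_id.smul contDiff_const))
    rw [zero_smul, add_zero] at hline
    rw [← hline, iteratedDeriv_fun_add contDiffAt_const
      (contDiffAt_const.mul (ContDiffAt.sum fun i _ => contDiffAt_const.mul (hcd i).contDiffAt)),
      iteratedDeriv_const, iteratedDeriv_const_mul_field, iteratedDeriv_fun_sum
      fun i _ => contDiffAt_const.mul (hcd i).contDiffAt]
    congr 2
    refine Finset.sum_congr rfl fun i _ => ?_
    rw [iteratedDeriv_const_mul_field, hlin, iteratedDeriv_comp_line hf hj]
    simp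
  rw [taylorPoly, Finset.sum_congr rfl fun j hj => by
    rw [hder j (Nat.lt_succ_iff.1 (Finset.mem_range.1 hj))]]
  simp only [mul_add, Finset.sum_add_distrib, taylorPoly, Finset.mul_sum]
  congr 1
  · simp
  · rw [Finset.sum_comm]
    exact Finset.sum_congr rfl fun i _ => Finset.sum_congr rfl fun j _ => by ring

/-- A rescaled sum of disjointly supported translates of a function of the Hölder class is in the
Hölder class, with a constant that does not depend on the number of translates. -/
theorem affine_sum_mem_holderClass {d : ℕ} {β M : ℝ} {ι : Type*} [Fintype ι]
    {f : Euc d → ℝ} (hf : f ∈ holderClass d β M) (hM : 0 ≤ M) {s : ι → ℝ} (hs : ∀ i, |s i| ≤ 1)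
    {c : ι → Euc d} (hdisj : ∀ y i j, y - c i ∈ tsupport f → y - c j ∈ tsupport f → i = j)
    {a h q : ℝ} (hh : 0 ≤ h) (hq : 0 ≤ q) :
    (fun x => a + h * ∑ i, s i * f (q • x - c i)) ∈ holderClass d β (2 * M * h * q ^ β) := by
  obtain ⟨hcd, hrem⟩ := hf
  refine ⟨contDiff_const.add (contDiff_const.mul (ContDiff.sum fun i _ => contDiff_const.mul
    (hcd.comp ((contDiff_const_smul q).sub contDiff_const)))), fun x x' => ?_⟩
  rw [taylorPoly_affine_sum hcd]
  set k := ⌈β⌉₊ - 1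
  set R : ι → ℝ := fun i => f (q • x' - c i) - taylorPoly d k f (q • x - c i) (q • x' - c i) with hR
  set ε := M * (q * ‖x' - x‖) ^ β with hε
  have hε0 : 0 ≤ ε := by positivity
  have hRle : ∀ i, |R i| ≤ ε := by
    intro i
    have := hrem (q • x - c i) (q • x' - c i)
    rwa [sub_sub_sub_cancel_right, ← smul_sub, norm_smul, Real.norm_of_nonneg hq] at this
  have hRzero : ∀ i, q • x' - c i ∉ tsupport f → q • x - c i ∉ tsupport f → R i = 0 := by
    intro i h1 h2
    have h3 : ∀ j, iteratedFDeriv ℝ j f (q • x - c i) = 0 := fun j =>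
      Function.notMem_support.1 fun h => h2 (support_iteratedFDeriv_subset j h)
    simp [hR, taylorPoly, h3, image_eq_zero_of_notMem_tsupport h1]
  have hcard : ∀ y, ∑ i, (if y - c i ∈ tsupport f then ε else 0) ≤ ε := by
    intro y
    rw [← Finset.sum_filter, Finset.sum_const, nsmul_eq_mul]
    refine mul_le_of_le_one_left hε0 ?_
    have : (Finset.univ.filter fun i => y - c i ∈ tsupport f).card ≤ 1 :=
      Finset.card_le_one.2 fun i hi j hj =>
        hdisj y i j (Finset.mem_filter.1 hi).2 (Finset.mem_filter.1 hj).2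
    exact_mod_cast this
  have hsplit : ∀ i, |R i| ≤ (if q • x' - c i ∈ tsupport f then ε else 0)
      + (if q • x - c i ∈ tsupport f then ε else 0) := by
    intro i
    by_cases h1 : q • x' - c i ∈ tsupport f
    · rw [if_pos h1]
      have : 0 ≤ if q • x - c i ∈ tsupport f then ε else 0 := by split_ifs <;> simp [hε0]
      linarith [hRle i]
    · by_cases h2 : q • x - c i ∈ tsupport f
      · simpa [h1, h2] using hRle i
      · simp [h1, h2, hRzero i h1 h2]
  have hsum : |∑ i, s i * R i| ≤ 2 * ε := by
    refine (Finset.abs_sum_le_sum_abs _ _).trans ?_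
    calc ∑ i, |s i * R i| ≤ ∑ i, ((if q • x' - c i ∈ tsupport f then ε else 0)
          + (if q • x - c i ∈ tsupport f then ε else 0)) := Finset.sum_le_sum fun i _ => by
            rw [abs_mul]
            exact (mul_le_of_le_one_left (abs_nonneg _) (hs i)).trans (hsplit i)
      _ ≤ 2 * ε := by
        rw [Finset.sum_add_distrib]; linarith [hcard (q • x'), hcard (q • x)]
  have hdiff : (a + h * ∑ i, s i * f (q • x' - c i)) -
      (a + h * ∑ i, s i * taylorPoly d k f (q • x - c i) (q • x' - c i)) = h * ∑ i, s i * R i := by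
    simp only [hR, mul_sub, Finset.sum_sub_distrib]; ring
  rw [hdiff, abs_mul, abs_of_nonneg hh]
  calc h * |∑ i, s i * R i| ≤ h * (2 * ε) := mul_le_mul_of_nonneg_left hsum hh
    _ = 2 * M * h * q ^ β * ‖x' - x‖ ^ β := by
      rw [hε, Real.mul_rpow hq (norm_nonneg _)]; ring

theorem pi_withDensity_eq {ι X : Type*} [Fintype ι] [MeasurableSpace X] (μ : Measure X)
    [IsProbabilityMeasure μ] {ρ : X → ℝ≥0∞} (hρ : Measurable ρ)
    [IsProbabilityMeasure (μ.withDensity ρ)] :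
    Measure.pi (fun _ : ι => μ.withDensity ρ)
      = (Measure.pi fun _ : ι => μ).withDensity fun x => ∏ i, ρ (x i) := by
  refine Measure.pi_eq fun s hs => ?_
  rw [withDensity_apply _ (MeasurableSet.univ_pi hs),
    ← lintegral_indicator (MeasurableSet.univ_pi hs)]
  have hind : (Set.univ.pi s).indicator (fun x : ι → X => ∏ i, ρ (x i))
      = fun x => ∏ i, (s i).indicator ρ (x i) := by
    funext x
    by_cases hx : x ∈ Set.univ.pi s
    · rw [Set.indicator_of_mem hx]
      exact Finset.prod_congr rfl fun i _ => (Set.indicator_of_mem (hx i trivial) _).symm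
    · rw [Set.indicator_of_notMem hx]
      obtain ⟨i, hi⟩ : ∃ i, x i ∉ s i := by simpa [Set.mem_pi] using hx
      exact (Finset.prod_eq_zero (Finset.mem_univ i) (Set.indicator_of_notMem hi _)).symm
  have hm : ∀ i, Measurable ((s i).indicator ρ) := fun i => hρ.indicator (hs i)
  rw [hind, ProbabilityTheory.lintegral_prod_eq_prod_lintegral_of_indepFun Finset.univ
    (fun i (x : ι → X) => (s i).indicator ρ (x i))
    (ProbabilityTheory.iIndepFun_pi fun i => (hm i).aemeasurable)
    fun i => (hm i).comp (measurable_pi_apply i)]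
  refine Finset.prod_congr rfl fun i _ => ?_
  rw [(measurePreserving_eval (fun _ : ι => μ) i).lintegral_comp (hm i),
    lintegral_indicator (hs i), withDensity_apply _ (hs i)]

theorem lintegral_pi_prod_eq_pow {ι X : Type*} [Fintype ι] [MeasurableSpace X] (μ : Measure X)
    [IsProbabilityMeasure μ] {ρ : X → ℝ≥0∞} (hρ : Measurable ρ) :
    ∫⁻ x, ∏ i, ρ (x i) ∂(Measure.pi fun _ : ι => μ) = (∫⁻ x, ρ x ∂μ) ^ Fintype.card ι := by
  rw [ProbabilityTheory.lintegral_prod_eq_prod_lintegral_of_indepFun Finset.univ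
    (fun i (x : ι → X) => ρ (x i))
    (ProbabilityTheory.iIndepFun_pi fun i => hρ.aemeasurable)
    fun i => hρ.comp (measurable_pi_apply i)]
  simp [(measurePreserving_eval (fun _ : ι => μ) _).lintegral_comp hρ]

theorem measurable_joint_kernel {d : ℕ} {η : Euc d → ℝ} (hη : Measurable η) :
    Measurable fun x : Euc d => ENNReal.ofReal (η x) • Measure.dirac (x, (1 : ℝ)) +
      ENNReal.ofReal (1 - η x) • Measure.dirac (x, (0 : ℝ)) := by
  refine Measure.measurable_of_measurable_coe _ fun s hs => ?_
  simp only [Measure.add_apply, Measure.smul_apply, smul_eq_mul, Measure.dirac_apply' _ hs]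
  have hind : ∀ y : ℝ, Measurable fun x : Euc d => s.indicator (1 : Euc d × ℝ → ℝ≥0∞) (x, y) :=
    fun y => (measurable_one.indicator hs).comp (measurable_id.prodMk measurable_const)
  exact (hη.ennreal_ofReal.mul (hind 1)).add
    ((measurable_const.sub hη).ennreal_ofReal.mul (hind 0))

theorem lintegral_joint {d : ℕ} (PX : Measure (Euc d)) {η : Euc d → ℝ} (hη : Measurable η)
    {f : Euc d × ℝ → ℝ≥0∞} (hf : Measurable f) :
    ∫⁻ p, f p ∂(joint d PX η) = ∫⁻ x, (ENNReal.ofReal (η x) * f (x, 1) +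
      ENNReal.ofReal (1 - η x) * f (x, 0)) ∂PX := by
  rw [joint, Measure.lintegral_bind (measurable_joint_kernel hη).aemeasurable hf.aemeasurable]
  simp [lintegral_add_measure, lintegral_smul_measure, lintegral_dirac' _ hf]

theorem isProbabilityMeasure_joint {d : ℕ} (PX : Measure (Euc d)) [IsProbabilityMeasure PX]
    {η : Euc d → ℝ} (hη : Measurable η) (h01 : ∀ x, η x ∈ Set.Icc (0 : ℝ) 1) :
    IsProbabilityMeasure (joint d PX η) := by
  refine ⟨?_⟩
  rw [← lintegral_one, lintegral_joint PX hη measurable_const]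
  simp [← ENNReal.ofReal_add (h01 _).1 (sub_nonneg.2 (h01 _).2)]

/-- The likelihood ratio of `joint d PX η'` with respect to `joint d PX η`. -/
def likelihoodRatio {d : ℕ} (η η' : Euc d → ℝ) (p : Euc d × ℝ) : ℝ≥0∞ :=
  if p.2 = 1 then ENNReal.ofReal (η' p.1 / η p.1) else ENNReal.ofReal ((1 - η' p.1) / (1 - η p.1))

theorem measurable_likelihoodRatio {d : ℕ} {η η' : Euc d → ℝ} (hη : Measurable η)
    (hη' : Measurable η') : Measurable (likelihoodRatio η η') := by
  refine Measurable.ite (measurable_snd (measurableSet_singleton 1)) ?_ ?_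
  · exact ((hη'.comp measurable_fst).div (hη.comp measurable_fst)).ennreal_ofReal
  · exact ((measurable_const.sub (hη'.comp measurable_fst)).div
      (measurable_const.sub (hη.comp measurable_fst))).ennreal_ofReal

theorem joint_eq_withDensity {d : ℕ} (PX : Measure (Euc d)) {η η' : Euc d → ℝ}
    (hη : Measurable η) (hη' : Measurable η') (h0 : ∀ x, 0 < η x) (h1 : ∀ x, η x < 1) :
    joint d PX η' = (joint d PX η).withDensity (likelihoodRatio η η') := by
  ext s hs
  have hm := measurable_likelihoodRatio hη hη'
  rw [withDensity_apply _ hs, ← lintegral_indicator hs,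
    lintegral_joint PX hη (hm.indicator hs), ← lintegral_indicator_one hs,
    lintegral_joint PX hη' (measurable_one.indicator hs)]
  refine lintegral_congr fun x => ?_
  have hx0 := h0 x
  have hx1 : 0 < 1 - η x := sub_pos.2 (h1 x)
  have e1 : ENNReal.ofReal (η x) * ENNReal.ofReal (η' x / η x) = ENNReal.ofReal (η' x) := by
    rw [← ENNReal.ofReal_mul hx0.le, mul_div_cancel₀ _ hx0.ne']
  have e0 : ENNReal.ofReal (1 - η x) * ENNReal.ofReal ((1 - η' x) / (1 - η x))
      = ENNReal.ofReal (1 - η' x) := by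
    rw [← ENNReal.ofReal_mul hx1.le, mul_div_cancel₀ _ hx1.ne']
  congr 1
  · by_cases hxs : (x, (1 : ℝ)) ∈ s <;> simp [hxs, likelihoodRatio, e1]
  · by_cases hxs : (x, (0 : ℝ)) ∈ s <;> simp [hxs, likelihoodRatio, e0]

theorem lintegral_likelihoodRatio_sq_le {d : ℕ} (PX : Measure (Euc d)) [IsProbabilityMeasure PX]
    {η η' : Euc d → ℝ} (hη : Measurable η) (hη' : Measurable η')
    (h : ∀ x, η x ∈ Set.Icc (1 / 4 : ℝ) (3 / 4)) {δ : ℝ} (hδ0 : 0 ≤ δ)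
    (hδ : ∫⁻ x, ENNReal.ofReal ((η x - η' x) ^ 2) ∂PX ≤ ENNReal.ofReal δ) :
    ∫⁻ p, likelihoodRatio η η' p ^ 2 ∂(joint d PX η) ≤ ENNReal.ofReal (1 + 16 / 3 * δ) := by
  rw [lintegral_joint PX hη ((measurable_likelihoodRatio hη hη').pow_const 2)]
  calc _ ≤ ∫⁻ x, (1 + ENNReal.ofReal (16 / 3) * ENNReal.ofReal ((η x - η' x) ^ 2)) ∂PX := by
        refine lintegral_mono fun x => ?_
        obtain ⟨h1, h2⟩ := h x
        have hx0 : 0 < η x := by linarith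
        have hx1 : 0 < 1 - η x := by linarith
        have hsq : ∀ a : ℝ, ENNReal.ofReal a ^ 2 ≤ ENNReal.ofReal (a ^ 2) := fun a => by
          rcases le_total 0 a with ha | ha
          · rw [ENNReal.ofReal_pow ha]
          · simp [ENNReal.ofReal_of_nonpos ha]
        simp only [likelihoodRatio, if_true, zero_ne_one, if_false]
        calc _ ≤ ENNReal.ofReal (η x) * ENNReal.ofReal ((η' x / η x) ^ 2) +
              ENNReal.ofReal (1 - η x) * ENNReal.ofReal (((1 - η' x) / (1 - η x)) ^ 2) := by
              gcongr <;> exact hsq _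
          _ = ENNReal.ofReal (η x * (η' x / η x) ^ 2 +
              (1 - η x) * ((1 - η' x) / (1 - η x)) ^ 2) := by
              rw [← ENNReal.ofReal_mul hx0.le, ← ENNReal.ofReal_mul hx1.le,
                ENNReal.ofReal_add (by positivity) (by positivity)]
          _ ≤ ENNReal.ofReal (1 + 16 / 3 * (η x - η' x) ^ 2) := by
              refine ENNReal.ofReal_le_ofReal ?_
              have e : η x * (η' x / η x) ^ 2 + (1 - η x) * ((1 - η' x) / (1 - η x)) ^ 2
                  = 1 + (η x - η' x) ^ 2 / (η x * (1 - η x)) := by field_simp; ring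
              rw [e, div_eq_inv_mul]
              have h3 : (η x * (1 - η x))⁻¹ ≤ 16 / 3 := by
                rw [inv_le_comm₀ (by positivity) (by norm_num)]; nlinarith
              gcongr
          _ = _ := by
              rw [ENNReal.ofReal_add one_pos.le (by positivity), ENNReal.ofReal_one,
                ENNReal.ofReal_mul (by norm_num)]
    _ = 1 + ENNReal.ofReal (16 / 3) * ∫⁻ x, ENNReal.ofReal ((η x - η' x) ^ 2) ∂PX := by
        rw [lintegral_add_left measurable_const, lintegral_const_mul]
        · simp
        · fun_prop
    _ ≤ 1 + ENNReal.ofReal (16 / 3) * ENNReal.ofReal δ := by gcongr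
    _ = ENNReal.ofReal (1 + 16 / 3 * δ) := by
        rw [ENNReal.ofReal_add one_pos.le (by positivity), ENNReal.ofReal_one,
          ENNReal.ofReal_mul (by norm_num)]

theorem withDensity_apply_sq_le {X : Type*} [MeasurableSpace X] (μ : Measure X) {ρ : X → ℝ≥0∞}
    (hρ : Measurable ρ) {s : Set X} (hs : MeasurableSet s) :
    μ.withDensity ρ s ^ 2 ≤ μ s * ∫⁻ x, ρ x ^ 2 ∂μ := by
  have h := ENNReal.lintegral_mul_le_Lp_mul_Lq μ Real.HolderConjugate.two_two
    ((measurable_one (α := ℝ≥0∞)).indicator hs).aemeasurable hρ.aemeasurable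
  have e1 : ∫⁻ x, (s.indicator (1 : X → ℝ≥0∞) * ρ) x ∂μ = μ.withDensity ρ s := by
    rw [withDensity_apply _ hs, ← lintegral_indicator hs]
    refine lintegral_congr fun x => ?_
    by_cases hx : x ∈ s <;> simp [hx]
  have e2 : ∫⁻ x, s.indicator (1 : X → ℝ≥0∞) x ^ (2 : ℝ) ∂μ = μ s := by
    rw [← lintegral_indicator_one hs]
    refine lintegral_congr fun x => ?_
    by_cases hx : x ∈ s <;> simp [hx]
  have e3 : ∀ a : ℝ≥0∞, (a ^ (1 / 2 : ℝ)) ^ 2 = a := fun a => by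
    rw [← ENNReal.rpow_natCast, ← ENNReal.rpow_mul]; norm_num
  rw [e1, e2] at h
  calc _ ≤ _ := pow_le_pow_left' h 2
    _ = _ := by
      rw [mul_pow, e3, e3]
      simp

/-- Two regression functions at small squared distance cannot be told apart by a test based on
`n` observations. -/
theorem sampleLaw_two_point {d n : ℕ} (PX : Measure (Euc d)) [IsProbabilityMeasure PX]
    {η η' : Euc d → ℝ} (hη : Measurable η) (hη' : Measurable η')
    (h : ∀ x, η x ∈ Set.Icc (1 / 4 : ℝ) (3 / 4)) (h' : ∀ x, η' x ∈ Set.Icc (0 : ℝ) 1)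
    {δ : ℝ} (hδ0 : 0 ≤ δ) (hδ : ∫⁻ x, ENNReal.ofReal ((η x - η' x) ^ 2) ∂PX ≤ ENNReal.ofReal δ)
    (hn : n * δ ≤ 3 / 16) {s : Set (Fin n → Euc d × ℝ)} (hs : MeasurableSet s) :
    1 / 16 ≤ (sampleLaw d n PX η).real s + (sampleLaw d n PX η').real sᶜ := by
  have hP := isProbabilityMeasure_joint PX hη
    fun x => ⟨by linarith [(h x).1], by linarith [(h x).2]⟩
  have hP' := isProbabilityMeasure_joint PX hη' h'
  have : IsProbabilityMeasure (sampleLaw d n PX η) := by unfold sampleLaw; infer_instance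
  have : IsProbabilityMeasure (sampleLaw d n PX η') := by unfold sampleLaw; infer_instance
  have hm := measurable_likelihoodRatio hη hη'
  have hw := joint_eq_withDensity PX hη hη' (fun x => by linarith [(h x).1])
    fun x => by linarith [(h x).2]
  have hpi : sampleLaw d n PX η' = (sampleLaw d n PX η).withDensity
      fun D => ∏ i, likelihoodRatio η η' (D i) := by
    have : IsProbabilityMeasure ((joint d PX η).withDensity (likelihoodRatio η η')) := hw ▸ hP'
    rw [sampleLaw, hw, pi_withDensity_eq _ hm, sampleLaw]
  have hK : ∫⁻ D, (∏ i, likelihoodRatio η η' (D i)) ^ 2 ∂(sampleLaw d n PX η)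
      ≤ ENNReal.ofReal 4 := by
    simp_rw [← Finset.prod_pow]
    rw [sampleLaw, lintegral_pi_prod_eq_pow _ (hm.pow_const 2), Fintype.card_fin]
    refine (pow_le_pow_left' (lintegral_likelihoodRatio_sq_le PX hη hη' h hδ0 hδ) n).trans ?_
    rw [← ENNReal.ofReal_pow (by positivity)]
    refine ENNReal.ofReal_le_ofReal ?_
    calc (1 + 16 / 3 * δ) ^ n ≤ Real.exp (16 / 3 * δ) ^ n := by
          gcongr; linarith [Real.add_one_le_exp (16 / 3 * δ)]
      _ = Real.exp (n * (16 / 3 * δ)) := (Real.exp_nat_mul _ _).symm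
      _ ≤ Real.exp 1 := Real.exp_le_exp.2 (by linarith)
      _ ≤ 4 := by linarith [Real.exp_one_lt_d9]
  have hsq : (sampleLaw d n PX η').real s ^ 2 ≤ (sampleLaw d n PX η).real s * 4 := by
    have hle := withDensity_apply_sq_le (sampleLaw d n PX η)
      (ρ := fun D => ∏ i, likelihoodRatio η η' (D i))
      (Finset.measurable_fun_prod _ fun i _ => hm.comp (measurable_pi_apply i)) hs
    rw [← hpi] at hle
    have hle' := ENNReal.toReal_mono (by finiteness) (hle.trans (mul_le_mul_right hK _))
    rwa [ENNReal.toReal_pow, ENNReal.toReal_mul, ENNReal.toReal_ofReal (by norm_num)] at hle'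
  have hle1 : (sampleLaw d n PX η').real s ≤ 1 := measureReal_le_one
  rw [probReal_compl_eq_one_sub hs]
  have h0 : 0 ≤ (sampleLaw d n PX η).real s := measureReal_nonneg
  have h0' : 0 ≤ (sampleLaw d n PX η').real s := measureReal_nonneg
  by_cases ht : 1 / 16 ≤ (sampleLaw d n PX η).real s
  · linarith
  · have : (sampleLaw d n PX η').real s ≤ 1 / 2 := by nlinarith
    linarith

theorem measurableSet_error {d n : ℕ} {fhat : (Fin n → Euc d × ℝ) → Euc d → Bool}
    (hf : Measurable (Function.uncurry fhat)) {B : Set (Euc d)} (hB : MeasurableSet B) (b : Bool) :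
    MeasurableSet {p : (Fin n → Euc d × ℝ) × Euc d | p.2 ∈ B ∧ fhat p.1 p.2 ≠ b} :=
  (measurable_snd hB).inter (hf (measurableSet_singleton b).compl)

theorem sum_measureReal_le_excessRisk {d : ℕ} {ι : Type*} [Fintype ι] (PX : Measure (Euc d))
    [IsProbabilityMeasure PX] {η : Euc d → ℝ} (hη : Measurable η)
    (h01 : ∀ x, η x ∈ Set.Icc (0 : ℝ) 1) {B : ι → Set (Euc d)} (hB : ∀ k, MeasurableSet (B k))
    (hdisj : Pairwise fun k l => Disjoint (B k) (B l)) {h : ℝ} (hh : 0 < h) {σ : ι → Bool}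
    (hηB : ∀ k, ∀ x ∈ B k, η x = 1 / 2 + if σ k then h else -h) {f : Euc d → Bool}
    (hf : Measurable f) :
    ∑ k, 2 * h * PX.real {x | x ∈ B k ∧ f x ≠ σ k} ≤ excessRisk d PX η f := by
  set g : Euc d → ℝ := fun x => if f x = plugin d η x then 0 else |2 * η x - 1| with hg
  have hplugin : Measurable (plugin d η) :=
    Measurable.ite (measurableSet_le measurable_const hη) measurable_const measurable_const
  have hgm : Measurable g := Measurable.ite (measurableSet_eq_fun hf hplugin) measurable_const
    (measurable_norm.comp ((hη.const_mul 2).sub_const 1))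
  have hg0 : ∀ x, 0 ≤ g x := fun x => by simp only [hg]; split_ifs <;> positivity
  have hg1 : ∀ x, g x ≤ 1 := fun x => by
    simp only [hg]
    split_ifs
    · exact zero_le_one
    · exact abs_le.2 ⟨by linarith [(h01 x).1], by linarith [(h01 x).2]⟩
  have hgi : Integrable g PX := Integrable.of_bound hgm.aestronglyMeasurable 1
    (Filter.Eventually.of_forall fun x => by
      rw [Real.norm_eq_abs, abs_of_nonneg (hg0 x)]; exact hg1 x)
  have hms : ∀ k, MeasurableSet {x | f x ≠ σ k} := fun k => hf (measurableSet_singleton _).compl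
  have hcell : ∀ k, ∫ x in B k, g x ∂PX = 2 * h * PX.real {x | x ∈ B k ∧ f x ≠ σ k} := by
    intro k
    have heq : ∀ x ∈ B k, g x = {x | f x ≠ σ k}.indicator (fun _ => 2 * h) x := by
      intro x hx
      have hp : plugin d η x = σ k := by
        unfold plugin
        rw [hηB k x hx]
        cases σ k
        · simp [hh]
        · simp [hh.le]
      simp only [hg, hp, Set.indicator_apply, Set.mem_ofPred_eq, ne_eq, ite_not]
      split_ifs with h1
      · rfl
      · rw [hηB k x hx]
        cases σ k
        · rw [abs_of_nonpos] <;> simp <;> linarith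
        · rw [abs_of_nonneg] <;> simp <;> linarith
    rw [setIntegral_congr_fun (hB k) heq, integral_indicator_const _ (hms k),
      measureReal_restrict_apply (hms k), smul_eq_mul, mul_comm, Set.inter_comm]
    rfl
  calc ∑ k, 2 * h * PX.real {x | x ∈ B k ∧ f x ≠ σ k} = ∫ x in ⋃ k, B k, g x ∂PX := by
        rw [integral_iUnion_fintype hB hdisj fun k => hgi.integrableOn]
        exact Finset.sum_congr rfl fun k _ => (hcell k).symm
    _ ≤ ∫ x, g x ∂PX := setIntegral_le_integral hgi (Filter.Eventually.of_forall hg0)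
    _ = excessRisk d PX η f := rfl

theorem sum_error_le_expectedExcess {d n : ℕ} {ι : Type*} [Fintype ι] (PX : Measure (Euc d))
    [IsProbabilityMeasure PX] {η : Euc d → ℝ} (hη : Measurable η)
    (h01 : ∀ x, η x ∈ Set.Icc (0 : ℝ) 1) {B : ι → Set (Euc d)} (hB : ∀ k, MeasurableSet (B k))
    (hdisj : Pairwise fun k l => Disjoint (B k) (B l)) {h : ℝ} (hh : 0 < h) {σ : ι → Bool}
    (hηB : ∀ k, ∀ x ∈ B k, η x = 1 / 2 + if σ k then h else -h)
    {fhat : (Fin n → Euc d × ℝ) → Euc d → Bool} (hf : Measurable (Function.uncurry fhat)) :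
    ∑ k, 2 * h * ((sampleLaw d n PX η).prod PX).real {p | p.2 ∈ B k ∧ fhat p.1 p.2 ≠ σ k}
      ≤ expectedExcess d n PX η fhat := by
  have hP := isProbabilityMeasure_joint PX hη h01
  have : IsProbabilityMeasure (sampleLaw d n PX η) := by unfold sampleLaw; infer_instance
  have hms : ∀ k, MeasurableSet {p : (Fin n → Euc d × ℝ) × Euc d | p.2 ∈ B k ∧
      fhat p.1 p.2 ≠ σ k} := fun k => measurableSet_error hf (hB k) _
  have hmD : ∀ k, Measurable fun D => PX {x | x ∈ B k ∧ fhat D x ≠ σ k} := fun k =>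
    measurable_measure_prodMk_left (hms k)
  have hreal : ∀ k, ((sampleLaw d n PX η).prod PX).real {p | p.2 ∈ B k ∧ fhat p.1 p.2 ≠ σ k}
      = ∫ D, PX.real {x | x ∈ B k ∧ fhat D x ≠ σ k} ∂(sampleLaw d n PX η) := by
    intro k
    simp only [Measure.real]
    rw [integral_toReal (hmD k).aemeasurable (Filter.Eventually.of_forall fun D =>
      measure_lt_top _ _), Measure.prod_apply (hms k)]
    rfl
  have hintg : ∀ k, Integrable (fun D => PX.real {x | x ∈ B k ∧ fhat D x ≠ σ k})
      (sampleLaw d n PX η) := fun k =>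
    Integrable.of_bound (hmD k).ennreal_toReal.aestronglyMeasurable 1
      (Filter.Eventually.of_forall fun D => by
        rw [Real.norm_eq_abs, abs_of_nonneg measureReal_nonneg]; exact measureReal_le_one)
  have hplugin : Measurable (plugin d η) :=
    Measurable.ite (measurableSet_le measurable_const hη) measurable_const measurable_const
  have hGm : Measurable fun p : (Fin n → Euc d × ℝ) × Euc d =>
      if fhat p.1 p.2 = plugin d η p.2 then (0 : ℝ) else |2 * η p.2 - 1| :=
    Measurable.ite (measurableSet_eq_fun hf (hplugin.comp measurable_snd)) measurable_const
      (measurable_norm.comp (((hη.comp measurable_snd).const_mul 2).sub_const 1))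
  have hexc : Integrable (fun D => excessRisk d PX η (fhat D)) (sampleLaw d n PX η) := by
    refine Integrable.of_bound
      hGm.stronglyMeasurable.integral_prod_right.aestronglyMeasurable 1
      (Filter.Eventually.of_forall fun D => ?_)
    refine (norm_integral_le_of_norm_le_const (C := 1) (Filter.Eventually.of_forall fun x => ?_)).trans
      (by simp)
    split_ifs
    · simp
    · rw [Real.norm_eq_abs, abs_abs]
      exact abs_le.2 ⟨by linarith [(h01 x).1], by linarith [(h01 x).2]⟩
  simp_rw [hreal, ← integral_const_mul]
  rw [← integral_finsetSum _ fun k _ => (hintg k).const_mul _]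
  exact integral_mono (integrable_finsetSum _ fun k _ => (hintg k).const_mul _) hexc fun D =>
    sum_measureReal_le_excessRisk PX hη h01 hB hdisj hh hηB (hf.comp measurable_prodMk_left)

theorem error_add_error_ge {d n : ℕ} (PX : Measure (Euc d)) [IsProbabilityMeasure PX]
    {η η' : Euc d → ℝ} (hη : Measurable η) (hη' : Measurable η')
    (h : ∀ x, η x ∈ Set.Icc (1 / 4 : ℝ) (3 / 4)) (h' : ∀ x, η' x ∈ Set.Icc (0 : ℝ) 1)
    {δ : ℝ} (hδ0 : 0 ≤ δ) (hδ : ∫⁻ x, ENNReal.ofReal ((η x - η' x) ^ 2) ∂PX ≤ ENNReal.ofReal δ)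
    (hn : n * δ ≤ 3 / 16) {B : Set (Euc d)} (hB : MeasurableSet B) (b : Bool)
    {fhat : (Fin n → Euc d × ℝ) → Euc d → Bool} (hf : Measurable (Function.uncurry fhat)) :
    PX.real B / 16 ≤ ((sampleLaw d n PX η).prod PX).real {p | p.2 ∈ B ∧ fhat p.1 p.2 ≠ b}
      + ((sampleLaw d n PX η').prod PX).real {p | p.2 ∈ B ∧ fhat p.1 p.2 ≠ !b} := by
  have hP := isProbabilityMeasure_joint PX hη
    fun x => ⟨by linarith [(h x).1], by linarith [(h x).2]⟩
  have hP' := isProbabilityMeasure_joint PX hη' h'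
  have : IsProbabilityMeasure (sampleLaw d n PX η) := by unfold sampleLaw; infer_instance
  have : IsProbabilityMeasure (sampleLaw d n PX η') := by unfold sampleLaw; infer_instance
  have hmx : ∀ x c, MeasurableSet {D | fhat D x ≠ c} := fun x c =>
    (hf.comp measurable_prodMk_right) (measurableSet_singleton c).compl
  have key : ∀ (μ : Measure (Fin n → Euc d × ℝ)) [IsProbabilityMeasure μ] (c : Bool),
      IntegrableOn (fun x => μ.real {D | fhat D x ≠ c}) B PX ∧
      (μ.prod PX).real {p | p.2 ∈ B ∧ fhat p.1 p.2 ≠ c}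
        = ∫ x in B, μ.real {D | fhat D x ≠ c} ∂PX := by
    intro μ _ c
    have hm : Measurable fun x => μ {D | fhat D x ≠ c} :=
      measurable_measure_prodMk_right (hf (measurableSet_singleton c).compl)
    refine ⟨Integrable.of_bound hm.ennreal_toReal.aestronglyMeasurable 1
      (Filter.Eventually.of_forall fun D => by
        rw [Real.norm_eq_abs, abs_of_nonneg measureReal_nonneg]; exact measureReal_le_one), ?_⟩
    simp only [Measure.real]
    rw [integral_toReal hm.aemeasurable (Filter.Eventually.of_forall fun D =>
      measure_lt_top _ _), Measure.prod_apply_symm (measurableSet_error hf hB c),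
      ← lintegral_indicator hB]
    congr 1
    refine lintegral_congr fun x => ?_
    by_cases hx : x ∈ B <;> simp [hx]
  obtain ⟨i1, e1⟩ := key (sampleLaw d n PX η) b
  obtain ⟨i2, e2⟩ := key (sampleLaw d n PX η') !b
  rw [e1, e2, ← integral_add i1 i2]
  calc PX.real B / 16 = ∫ _ in B, (1 / 16 : ℝ) ∂PX := by
        rw [setIntegral_const, smul_eq_mul]; ring
    _ ≤ _ := by
      refine setIntegral_mono_on (integrable_const _).integrableOn (i1.add i2) hB fun x _ => ?_
      have hcompl : {D | fhat D x ≠ !b} = {D | fhat D x ≠ b}ᶜ := by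
        ext D
        cases hD : fhat D x <;> cases b <;> simp [hD]
      rw [hcompl]
      exact sampleLaw_two_point PX hη hη' h h' hδ0 hδ hn (hmx x b)

theorem exists_expectedExcess_ge {d n : ℕ} {ι : Type*} [Fintype ι] (PX : Measure (Euc d))
    [IsProbabilityMeasure PX] {η : (ι → Bool) → Euc d → ℝ} (hη : ∀ σ, Measurable (η σ))
    (hrange : ∀ σ x, η σ x ∈ Set.Icc (1 / 4 : ℝ) (3 / 4)) {B : ι → Set (Euc d)}
    (hB : ∀ k, MeasurableSet (B k)) (hdisj : Pairwise fun k l => Disjoint (B k) (B l))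
    {h : ℝ} (hh : 0 < h) (hηB : ∀ σ k, ∀ x ∈ B k, η σ x = 1 / 2 + if σ k then h else -h)
    {w : ℝ} (hw : ∀ k, PX.real (B k) = w) {δ : ℝ} (hδ0 : 0 ≤ δ)
    (hδ : ∀ σ k, ∫⁻ x, ENNReal.ofReal ((η σ x - η (Function.update σ k !(σ k)) x) ^ 2) ∂PX
      ≤ ENNReal.ofReal δ) (hn : n * δ ≤ 3 / 16)
    {fhat : (Fin n → Euc d × ℝ) → Euc d → Bool} (hf : Measurable (Function.uncurry fhat)) :
    ∃ σ, Fintype.card ι * (h * w / 16) ≤ expectedExcess d n PX (η σ) fhat := by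
  have h01 : ∀ σ x, η σ x ∈ Set.Icc (0 : ℝ) 1 := fun σ x =>
    ⟨by linarith [(hrange σ x).1], by linarith [(hrange σ x).2]⟩
  set a : (ι → Bool) → ι → ℝ := fun σ k =>
    ((sampleLaw d n PX (η σ)).prod PX).real {p | p.2 ∈ B k ∧ fhat p.1 p.2 ≠ σ k} with ha
  have hpair : ∀ σ k, w / 16 ≤ a σ k + a (Function.update σ k !(σ k)) k := by
    intro σ k
    have := error_add_error_ge PX (hη σ) (hη (Function.update σ k !(σ k))) (hrange σ) (h01 _) hδ0
      (hδ σ k) hn (hB k) (σ k) hf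
    rw [hw] at this
    simpa [ha] using this
  have hflip : ∀ k, ∑ σ, a (Function.update σ k !(σ k)) k = ∑ σ, a σ k := by
    intro k
    have hinv : Function.Involutive fun σ : ι → Bool => Function.update σ k !(σ k) :=
      fun σ => by simp
    exact Equiv.sum_comp hinv.toPerm fun σ => a σ k
  have hsum : ∀ k, ∑ _σ : ι → Bool, w / 32 ≤ ∑ σ, a σ k := by
    intro k
    have h1 : ∑ _σ : ι → Bool, w / 16 ≤ ∑ σ, (a σ k + a (Function.update σ k !(σ k)) k) :=
      Finset.sum_le_sum fun σ _ => hpair σ k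
    rw [Finset.sum_add_distrib, hflip] at h1
    simp only [Finset.sum_const, nsmul_eq_mul] at h1 ⊢
    linarith
  have htotal : ∑ _σ : ι → Bool, Fintype.card ι * (h * w / 16) ≤ ∑ σ, ∑ k, 2 * h * a σ k := by
    rw [Finset.sum_comm]
    calc ∑ _σ : ι → Bool, Fintype.card ι * (h * w / 16)
        = ∑ _k : ι, 2 * h * ∑ _σ : ι → Bool, w / 32 := by
          simp only [Finset.sum_const, nsmul_eq_mul, Finset.card_univ]; ring
      _ ≤ ∑ k, ∑ σ, 2 * h * a σ k := Finset.sum_le_sum fun k _ => by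
          rw [← Finset.mul_sum]
          exact mul_le_mul_of_nonneg_left (hsum k) (by positivity)
  obtain ⟨σ, -, hσ⟩ := Finset.exists_le_of_sum_le Finset.univ_nonempty htotal
  exact ⟨σ, hσ.trans (sum_error_le_expectedExcess PX (hη σ) (h01 σ) hB hdisj hh (hηB σ) hf)⟩

theorem holderClass_mono {d : ℕ} {β L L' : ℝ} (h : L ≤ L') :
    holderClass d β L ⊆ holderClass d β L' := fun _ hg =>
  ⟨hg.1, fun x x' => (hg.2 x x').trans (mul_le_mul_of_nonneg_right h (by positivity))⟩

theorem norm_le_card_of_abs_le_one {d : ℕ} {x : Euc d} (hx : ∀ i, |x i| ≤ 1) : ‖x‖ ≤ d := by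
  rw [EuclideanSpace.norm_eq, Real.sqrt_le_left (by positivity)]
  calc ∑ i, ‖x i‖ ^ 2 ≤ ∑ _i : Fin d, (1 : ℝ) := Finset.sum_le_sum fun i _ =>
        pow_le_one₀ (norm_nonneg _) (hx i)
    _ = d := by simp
    _ ≤ (d : ℝ) ^ 2 := by exact_mod_cast Nat.le_self_pow two_ne_zero d

theorem regularSet_closedBall {d : ℕ} {R r₀ : ℝ} (hR : 0 < R) (h : r₀ ≤ R) :
    regularSet d ((1 / 2) ^ d) r₀ (Metric.closedBall 0 R) := by
  intro x hx r hr hr₀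
  rw [mem_closedBall_zero_iff] at hx
  have hrR : r / (2 * R) ≤ 1 := by rw [div_le_one (by positivity)]; linarith
  have hsub : Metric.closedBall ((1 - r / (2 * R)) • x) (1 / 2 * r)
      ⊆ Metric.closedBall 0 R ∩ Metric.closedBall x r := by
    intro y hy
    rw [mem_closedBall_iff_norm] at hy
    have hfrac : r / (2 * R) * ‖x‖ ≤ r / 2 := by
      calc r / (2 * R) * ‖x‖ ≤ r / (2 * R) * R := by gcongr
        _ = r / 2 := by field_simp
    constructor
    · rw [mem_closedBall_zero_iff]
      calc ‖y‖ ≤ ‖y - (1 - r / (2 * R)) • x‖ + ‖(1 - r / (2 * R)) • x‖ := norm_le_norm_sub_add _ _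
        _ ≤ 1 / 2 * r + (1 - r / (2 * R)) * R := by
          rw [norm_smul, Real.norm_of_nonneg (sub_nonneg.2 hrR)]
          gcongr
        _ = R := by field_simp; ring
    · rw [mem_closedBall_iff_norm]
      calc ‖y - x‖ ≤ ‖y - (1 - r / (2 * R)) • x‖ + ‖(1 - r / (2 * R)) • x - x‖ :=
            norm_sub_le_norm_sub_add_norm_sub _ _ _
        _ ≤ 1 / 2 * r + r / 2 := by
          have e : (1 - r / (2 * R)) • x - x = -((r / (2 * R)) • x) := by module
          rw [e, norm_neg, norm_smul, Real.norm_of_nonneg (by positivity)]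
          gcongr
        _ = r := by ring
  refine le_trans (le_of_eq ?_) (measure_mono hsub)
  rw [Measure.addHaar_closedBall_mul _ _ (by norm_num) hr.le, Measure.addHaar_closedBall_center]
  simp

/-- The points of `{0, …, q - 1}^d`. -/
def latticePoint {d q : ℕ} (k : Fin d → Fin q) : Euc d := WithLp.toLp 2 fun i => ((k i : ℕ) : ℝ)

/-- Small disjoint balls centred at the points of the grid `{0, 1/q, …, (q - 1)/q}^d`. -/
def cell {d q : ℕ} (k : Fin d → Fin q) : Set (Euc d) :=
  Metric.closedBall ((q : ℝ)⁻¹ • latticePoint k) ((q : ℝ)⁻¹ * (1 / 4))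

/-- A ball away from the cells, which carries the mass that is not in the cells. -/
def reservoir (d : ℕ) : Set (Euc d) := Metric.closedBall (WithLp.toLp 2 fun _ => (-1 : ℝ)) (1 / 4)

/-- A smooth bump function equal to `1` on the ball of radius `1 / 4`. -/
def stdBump (d : ℕ) : ContDiffBump (0 : Euc d) := ⟨1 / 4, 1 / 3, by norm_num, by norm_num⟩

/-- The regression function with a bump of height `±h` on each cell. -/
def bumpRegression (d q : ℕ) (h : ℝ) (σ : (Fin d → Fin q) → Bool) (x : Euc d) : ℝ :=
  1 / 2 + h * ∑ k, (if σ k then 1 else -1) * stdBump d ((q : ℝ) • x - latticePoint k)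

/-- The density equal to `a` on the cells and to `b` on the reservoir. -/
def cellDensity (d q : ℕ) (a b : ℝ) (x : Euc d) : ℝ :=
  (⋃ k : Fin d → Fin q, cell k).indicator (fun _ => a) x + (reservoir d).indicator (fun _ => b) x

/-- The measure with density `cellDensity`. -/
def cellMeasure (d q : ℕ) (a b : ℝ) : Measure (Euc d) :=
  volume.withDensity fun x => ENNReal.ofReal (cellDensity d q a b x)

theorem tsupport_stdBump (d : ℕ) : tsupport (stdBump d) = Metric.closedBall 0 (1 / 3) :=
  (stdBump d).tsupport_eq

theorem latticePoint_unique {d q : ℕ} {y : Euc d} {k l : Fin d → Fin q}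
    (hk : y - latticePoint k ∈ tsupport (stdBump d))
    (hl : y - latticePoint l ∈ tsupport (stdBump d)) : k = l := by
  rw [tsupport_stdBump, mem_closedBall_zero_iff] at hk hl
  funext i
  have h1 := abs_le.1 ((PiLp.norm_apply_le (y - latticePoint k) i).trans hk)
  have h2 := abs_le.1 ((PiLp.norm_apply_le (y - latticePoint l) i).trans hl)
  simp only [latticePoint, PiLp.sub_apply] at h1 h2
  have h3 : ((k i : ℕ) : ℝ) < (l i : ℕ) + 1 := by linarith
  have h4 : ((l i : ℕ) : ℝ) < (k i : ℕ) + 1 := by linarith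
  norm_cast at h3 h4
  exact Fin.ext (by omega)

theorem mem_cell_iff {d q : ℕ} (hq : 1 ≤ q) {k : Fin d → Fin q} {x : Euc d} :
    x ∈ cell k ↔ (q : ℝ) • x - latticePoint k ∈ Metric.closedBall (0 : Euc d) (1 / 4) := by
  have hq0 : (0 : ℝ) < q := by exact_mod_cast hq
  have e : (q : ℝ) • x - latticePoint k = (q : ℝ) • (x - (q : ℝ)⁻¹ • latticePoint k) := by
    rw [smul_sub, smul_inv_smul₀ hq0.ne']
  rw [cell, mem_closedBall_iff_norm, mem_closedBall_zero_iff, e, norm_smul,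
    Real.norm_of_nonneg hq0.le, le_inv_mul_iff₀ hq0]

theorem mem_tsupport_of_mem_cell {d q : ℕ} (hq : 1 ≤ q) {k : Fin d → Fin q} {x : Euc d}
    (hx : x ∈ cell k) : (q : ℝ) • x - latticePoint k ∈ tsupport (stdBump d) := by
  rw [tsupport_stdBump]
  exact Metric.closedBall_subset_closedBall (by norm_num) ((mem_cell_iff hq).1 hx)

theorem notMem_tsupport_of_mem_reservoir {d q : ℕ} (hd : 1 ≤ d) (hq : 1 ≤ q)
    (k : Fin d → Fin q) {x : Euc d} (hx : x ∈ reservoir d) :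
    (q : ℝ) • x - latticePoint k ∉ tsupport (stdBump d) := by
  rw [tsupport_stdBump, mem_closedBall_zero_iff]
  intro h
  rw [reservoir, mem_closedBall_iff_norm] at hx
  have h1 := abs_le.1 ((PiLp.norm_apply_le _ (⟨0, hd⟩ : Fin d)).trans h)
  have h2 := abs_le.1 ((PiLp.norm_apply_le _ (⟨0, hd⟩ : Fin d)).trans hx)
  simp only [latticePoint, PiLp.sub_apply, PiLp.smul_apply, smul_eq_mul] at h1 h2
  have hq1 : (1 : ℝ) ≤ q := by exact_mod_cast hq
  have hk : (0 : ℝ) ≤ ((k ⟨0, hd⟩ : ℕ) : ℝ) := Nat.cast_nonneg _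
  nlinarith [h1.1, h2.2]

theorem disjoint_cell {d q : ℕ} (hq : 1 ≤ q) :
    Pairwise fun k l : Fin d → Fin q => Disjoint (cell k) (cell l) := fun _ _ hkl =>
  Set.disjoint_left.2 fun _ hx hx' =>
    hkl (latticePoint_unique (mem_tsupport_of_mem_cell hq hx) (mem_tsupport_of_mem_cell hq hx'))

theorem disjoint_cells_reservoir {d q : ℕ} (hd : 1 ≤ d) (hq : 1 ≤ q) :
    Disjoint (⋃ k : Fin d → Fin q, cell k) (reservoir d) :=
  Set.disjoint_left.2 fun x hx hx' => by
    obtain ⟨k, hk⟩ := Set.mem_iUnion.1 hx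
    exact notMem_tsupport_of_mem_reservoir hd hq k hx' (mem_tsupport_of_mem_cell hq hk)

theorem measurableSet_cell {d q : ℕ} (k : Fin d → Fin q) : MeasurableSet (cell k) :=
  Metric.isClosed_closedBall.measurableSet

theorem measurableSet_cells (d q : ℕ) : MeasurableSet (⋃ k : Fin d → Fin q, cell k) :=
  MeasurableSet.iUnion measurableSet_cell

theorem measurableSet_reservoir (d : ℕ) : MeasurableSet (reservoir d) :=
  Metric.isClosed_closedBall.measurableSet

theorem bumpRegression_of_mem_tsupport {d q : ℕ} (h : ℝ) (σ : (Fin d → Fin q) → Bool)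
    {k : Fin d → Fin q} {x : Euc d} (hx : (q : ℝ) • x - latticePoint k ∈ tsupport (stdBump d)) :
    bumpRegression d q h σ x = 1 / 2 + h *
      ((if σ k then 1 else -1) * stdBump d ((q : ℝ) • x - latticePoint k)) := by
  rw [bumpRegression, Finset.sum_eq_single k]
  · intro l _ hl
    rw [image_eq_zero_of_notMem_tsupport fun hl' => hl (latticePoint_unique hl' hx), mul_zero]
  · simp

theorem bumpRegression_of_mem_cell {d q : ℕ} (hq : 1 ≤ q) (h : ℝ) (σ : (Fin d → Fin q) → Bool)
    (k : Fin d → Fin q) {x : Euc d} (hx : x ∈ cell k) :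
    bumpRegression d q h σ x = 1 / 2 + if σ k then h else -h := by
  rw [bumpRegression_of_mem_tsupport h σ (mem_tsupport_of_mem_cell hq hx),
    (stdBump d).one_of_mem_closedBall ((mem_cell_iff hq).1 hx)]
  split_ifs <;> simp

theorem bumpRegression_of_mem_reservoir {d q : ℕ} (hd : 1 ≤ d) (hq : 1 ≤ q) (h : ℝ)
    (σ : (Fin d → Fin q) → Bool) {x : Euc d} (hx : x ∈ reservoir d) :
    bumpRegression d q h σ x = 1 / 2 := by
  rw [bumpRegression, Finset.sum_eq_zero, mul_zero, add_zero]
  intro k _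
  rw [image_eq_zero_of_notMem_tsupport (notMem_tsupport_of_mem_reservoir hd hq k hx), mul_zero]

theorem abs_bumpRegression_sub_half_le {d q : ℕ} {h : ℝ} (hh : 0 ≤ h)
    (σ : (Fin d → Fin q) → Bool) (x : Euc d) : |bumpRegression d q h σ x - 1 / 2| ≤ h := by
  by_cases hx : ∃ k : Fin d → Fin q, (q : ℝ) • x - latticePoint k ∈ tsupport (stdBump d)
  · obtain ⟨k, hk⟩ := hx
    rw [bumpRegression_of_mem_tsupport h σ hk, add_sub_cancel_left, abs_mul, abs_of_nonneg hh,
      abs_mul, abs_of_nonneg (stdBump d).nonneg]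
    have h1 : |if σ k then (1 : ℝ) else -1| = 1 := by split_ifs <;> simp
    rw [h1, one_mul]
    exact mul_le_of_le_one_right hh (stdBump d).le_one
  · rw [not_exists] at hx
    rw [bumpRegression, Finset.sum_eq_zero fun k _ => by
      rw [image_eq_zero_of_notMem_tsupport (hx k), mul_zero]]
    simpa using hh

theorem continuous_bumpRegression (d q : ℕ) (h : ℝ) (σ : (Fin d → Fin q) → Bool) :
    Continuous (bumpRegression d q h σ) :=
  continuous_const.add (continuous_const.mul (continuous_finsetSum _ fun _ _ =>
    continuous_const.mul ((stdBump d).continuous.comp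
      ((continuous_const_smul _).sub continuous_const))))

theorem cellMeasure_apply {d q : ℕ} {a b : ℝ} (ha : 0 ≤ a) (hb : 0 ≤ b) {s : Set (Euc d)}
    (hs : MeasurableSet s) :
    cellMeasure d q a b s = ENNReal.ofReal a * volume ((⋃ k : Fin d → Fin q, cell k) ∩ s)
      + ENNReal.ofReal b * volume (reservoir d ∩ s) := by
  have hden : ∀ x, ENNReal.ofReal (cellDensity d q a b x) =
      (⋃ k : Fin d → Fin q, cell k).indicator (fun _ => ENNReal.ofReal a) x
        + (reservoir d).indicator (fun _ => ENNReal.ofReal b) x := by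
    intro x
    rw [cellDensity, ENNReal.ofReal_add (Set.indicator_nonneg (fun _ _ => ha) _)
      (Set.indicator_nonneg (fun _ _ => hb) _)]
    congr 1
    · by_cases hx : x ∈ ⋃ k : Fin d → Fin q, cell k
      · rw [Set.indicator_of_mem hx, Set.indicator_of_mem hx]
      · rw [Set.indicator_of_notMem hx, Set.indicator_of_notMem hx, ENNReal.ofReal_zero]
    · by_cases hx : x ∈ reservoir d <;> simp [hx]
  rw [cellMeasure, withDensity_apply _ hs]
  simp_rw [hden]
  rw [lintegral_add_left (measurable_const.indicator (measurableSet_cells d q)),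
    lintegral_indicator_const (measurableSet_cells d q),
    lintegral_indicator_const (measurableSet_reservoir d),
    Measure.restrict_apply (measurableSet_cells d q),
    Measure.restrict_apply (measurableSet_reservoir d)]

theorem ae_mem_cells_or_reservoir {d q : ℕ} {a b : ℝ} (ha : 0 ≤ a) (hb : 0 ≤ b) :
    ∀ᵐ x ∂(cellMeasure d q a b), (∃ k : Fin d → Fin q, x ∈ cell k) ∨ x ∈ reservoir d := by
  have hm := (measurableSet_cells d q).union (measurableSet_reservoir d)
  have h0 : cellMeasure d q a b ((⋃ k : Fin d → Fin q, cell k) ∪ reservoir d)ᶜ = 0 := by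
    rw [cellMeasure_apply ha hb hm.compl, Set.compl_union]
    have e1 : (⋃ k : Fin d → Fin q, cell k) ∩ ((⋃ k : Fin d → Fin q, cell k)ᶜ ∩ (reservoir d)ᶜ)
        = ∅ := by rw [← Set.inter_assoc, Set.inter_compl_self, Set.empty_inter]
    have e2 : reservoir d ∩ ((⋃ k : Fin d → Fin q, cell k)ᶜ ∩ (reservoir d)ᶜ) = ∅ := by
      rw [Set.inter_left_comm, Set.inter_compl_self, Set.inter_empty]
    rw [e1, e2, measure_empty, mul_zero, mul_zero, add_zero]
  filter_upwards [compl_mem_ae_iff.2 h0] with x hx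
  rw [compl_compl] at hx
  exact hx.imp_left Set.mem_iUnion.1

theorem volume_reservoir (d : ℕ) :
    volume (reservoir d) = volume (Metric.closedBall (0 : Euc d) (1 / 4)) :=
  Measure.addHaar_closedBall_center _ _ _

theorem volume_cell {d q : ℕ} (k : Fin d → Fin q) :
    volume (cell k) = ENNReal.ofReal (((q : ℝ)⁻¹) ^ d)
      * volume (Metric.closedBall (0 : Euc d) (1 / 4)) := by
  rw [cell, Measure.addHaar_closedBall_mul _ _ (by positivity) (by norm_num)]
  simp

theorem cellMeasure_cell {d q : ℕ} (hd : 1 ≤ d) (hq : 1 ≤ q) {a b : ℝ} (ha : 0 ≤ a) (hb : 0 ≤ b)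
    (k : Fin d → Fin q) :
    cellMeasure d q a b (cell k) = ENNReal.ofReal
      (a * (((q : ℝ)⁻¹) ^ d * volume.real (Metric.closedBall (0 : Euc d) (1 / 4)))) := by
  rw [cellMeasure_apply ha hb (measurableSet_cell k),
    Set.inter_eq_self_of_subset_right (Set.subset_iUnion _ k),
    ((disjoint_cells_reservoir hd hq).mono_left (Set.subset_iUnion _ k)).symm.inter_eq,
    measure_empty, mul_zero, add_zero, volume_cell, ENNReal.ofReal_mul ha,
    ENNReal.ofReal_mul (by positivity), Measure.real,
    ENNReal.ofReal_toReal measure_closedBall_lt_top.ne]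

theorem cellMeasure_cells {d q : ℕ} (hd : 1 ≤ d) (hq : 1 ≤ q) {a b : ℝ} (ha : 0 ≤ a) (hb : 0 ≤ b) :
    cellMeasure d q a b (⋃ k : Fin d → Fin q, cell k) = ENNReal.ofReal
      (a * volume.real (Metric.closedBall (0 : Euc d) (1 / 4))) := by
  rw [measure_iUnion (disjoint_cell hq) measurableSet_cell, tsum_fintype]
  simp_rw [cellMeasure_cell hd hq ha hb]
  have hq0 : (q : ℝ) ≠ 0 := by positivity
  rw [← ENNReal.ofReal_sum_of_nonneg fun _ _ => by positivity, Finset.sum_const, nsmul_eq_mul]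
  congr 1
  simp only [Finset.card_univ, Fintype.card_pi, Fintype.card_fin, Finset.prod_const, Nat.cast_pow]
  rw [inv_pow]
  field_simp

theorem isProbabilityMeasure_cellMeasure {d q : ℕ} (hd : 1 ≤ d) (hq : 1 ≤ q) {a b : ℝ} (ha : 0 ≤ a)
    (hb : 0 ≤ b) (hab : (a + b) * volume.real (Metric.closedBall (0 : Euc d) (1 / 4)) = 1) :
    IsProbabilityMeasure (cellMeasure d q a b) := by
  have hres : cellMeasure d q a b (reservoir d) = ENNReal.ofReal
      (b * volume.real (Metric.closedBall (0 : Euc d) (1 / 4))) := by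
    rw [cellMeasure_apply ha hb (measurableSet_reservoir d),
      (disjoint_cells_reservoir hd hq).inter_eq, measure_empty, mul_zero, zero_add,
      Set.inter_self, volume_reservoir, ENNReal.ofReal_mul hb, Measure.real,
      ENNReal.ofReal_toReal measure_closedBall_lt_top.ne]
  have hunion : cellMeasure d q a b Set.univ =
      cellMeasure d q a b ((⋃ k : Fin d → Fin q, cell k) ∪ reservoir d) := by
    refine measure_congr ?_
    filter_upwards [ae_mem_cells_or_reservoir (q := q) ha hb] with x hx
    have hx' : x ∈ (⋃ k : Fin d → Fin q, cell k) ∪ reservoir d := by simpa using hx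
    exact propext ⟨fun _ => hx', fun _ => trivial⟩
  refine ⟨?_⟩
  rw [hunion, measure_union (disjoint_cells_reservoir hd hq) (measurableSet_reservoir d), hres,
    cellMeasure_cells hd hq ha hb, ← ENNReal.ofReal_add (by positivity) (by positivity),
    ← add_mul, hab, ENNReal.ofReal_one]

theorem cellDensity_nonneg {d q : ℕ} {a b : ℝ} (ha : 0 ≤ a) (hb : 0 ≤ b) (x : Euc d) :
    0 ≤ cellDensity d q a b x :=
  add_nonneg (Set.indicator_nonneg (fun _ _ => ha) _) (Set.indicator_nonneg (fun _ _ => hb) _)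

theorem cellDensity_le {d q : ℕ} {a b : ℝ} (ha : 0 ≤ a) (hb : 0 ≤ b) (x : Euc d) :
    cellDensity d q a b x ≤ a + b :=
  add_le_add (Set.indicator_apply_le' (fun _ => le_rfl) fun _ => ha)
    (Set.indicator_apply_le' (fun _ => le_rfl) fun _ => hb)

theorem cells_union_reservoir_subset {d q : ℕ} (hq : 1 ≤ q) :
    (⋃ k : Fin d → Fin q, cell k) ∪ reservoir d ⊆ Metric.closedBall (0 : Euc d) (d + 2) := by
  have hq0 : (0 : ℝ) < q := by exact_mod_cast hq
  have hball : ∀ (c : Euc d) (r : ℝ), (∀ i, |c i| ≤ 1) → r ≤ 1 →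
      Metric.closedBall c r ⊆ Metric.closedBall 0 (d + 2) := by
    intro c r hc hr
    refine Metric.closedBall_subset_closedBall' ?_
    rw [dist_zero_right]
    linarith [norm_le_card_of_abs_le_one hc]
  refine Set.union_subset (Set.iUnion_subset fun k => hball _ _ (fun i => ?_) ?_)
    (hball _ _ (fun i => by simp) (by norm_num))
  · have hk : ((k i : ℕ) : ℝ) ≤ q := by exact_mod_cast (k i).2.le
    simp only [latticePoint, PiLp.smul_apply, smul_eq_mul]
    rw [abs_of_nonneg (by positivity), inv_mul_le_iff₀ hq0, mul_one]
    exact hk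
  · have : (q : ℝ)⁻¹ ≤ 1 := inv_le_one_of_one_le₀ (by exact_mod_cast hq)
    linarith

theorem mildDensity_cellMeasure {d q : ℕ} (hq : 1 ≤ q) {a b μmax : ℝ} (ha : 0 ≤ a) (hb : 0 ≤ b)
    (hμ : a + b ≤ μmax) :
    mildDensity d ((1 / 2) ^ d) 1 μmax (Metric.closedBall 0 (d + 2)) (cellMeasure d q a b) := by
  refine ⟨Metric.closedBall 0 (d + 2), isCompact_closedBall _ _, subset_rfl,
    regularSet_closedBall (by positivity) (by linarith [(Nat.cast_nonneg d : (0 : ℝ) ≤ d)]),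
    cellDensity d q a b, fun x _ => ⟨cellDensity_nonneg ha hb x, (cellDensity_le ha hb x).trans hμ⟩,
    fun x hx => ?_, rfl⟩
  have hcells : x ∉ ⋃ k : Fin d → Fin q, cell k := fun h =>
    hx (cells_union_reservoir_subset hq (Or.inl h))
  have hres : x ∉ reservoir d := fun h => hx (cells_union_reservoir_subset hq (Or.inr h))
  rw [cellDensity, Set.indicator_of_notMem hcells, Set.indicator_of_notMem hres, add_zero]

theorem margin_bumpRegression {d q : ℕ} (hd : 1 ≤ d) (hq : 1 ≤ q) {a b h α C₀ : ℝ} (ha : 0 ≤ a)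
    (hb : 0 ≤ b) (hh : 0 < h) (hα : 0 < α) (hC₀ : 0 ≤ C₀)
    (hm : a * volume.real (Metric.closedBall (0 : Euc d) (1 / 4)) ≤ C₀ * h ^ α)
    (σ : (Fin d → Fin q) → Bool) :
    margin d α C₀ (cellMeasure d q a b) (bumpRegression d q h σ) := by
  intro t ht
  have hcell : ∀ k : Fin d → Fin q, ∀ x ∈ cell k, |bumpRegression d q h σ x - 1 / 2| = h := by
    intro k x hx
    rw [bumpRegression_of_mem_cell hq h σ k hx, add_sub_cancel_left]
    split_ifs <;> simp [hh.le]
  have hsub : ∀ᵐ x ∂(cellMeasure d q a b), x ∈ {x | 0 < |bumpRegression d q h σ x - 1 / 2| ∧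
      |bumpRegression d q h σ x - 1 / 2| ≤ t} → h ≤ t ∧ x ∈ ⋃ k : Fin d → Fin q, cell k := by
    filter_upwards [ae_mem_cells_or_reservoir (q := q) ha hb] with x hx hxt
    rcases hx with ⟨k, hk⟩ | hx
    · exact ⟨hcell k x hk ▸ hxt.2, Set.mem_iUnion.2 ⟨k, hk⟩⟩
    · have h0 := hxt.1
      simp [bumpRegression_of_mem_reservoir hd hq h σ hx] at h0
  by_cases hht : h ≤ t
  · have hle : cellMeasure d q a b _ ≤ cellMeasure d q a b (⋃ k : Fin d → Fin q, cell k) :=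
      measure_mono_ae (hsub.mono fun x hx hxt => (hx hxt).2)
    refine hle.trans ?_
    rw [cellMeasure_cells hd hq ha hb]
    refine ENNReal.ofReal_le_ofReal (hm.trans ?_)
    gcongr
  · refine le_of_eq_of_le (measure_eq_zero_iff_ae_notMem.2 ?_) zero_le
    exact hsub.mono fun x hx hxt => hht (hx hxt).1

theorem bumpRegression_mem_holderClass {d q : ℕ} {β M h : ℝ} (hM : 0 ≤ M) (hh : 0 ≤ h)
    (hf : (stdBump d : Euc d → ℝ) ∈ holderClass d β M) (σ : (Fin d → Fin q) → Bool) :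
    bumpRegression d q h σ ∈ holderClass d β (2 * M * h * (q : ℝ) ^ β) :=
  affine_sum_mem_holderClass hf hM (fun i => by split_ifs <;> simp)
    (fun _ _ _ => latticePoint_unique) hh (Nat.cast_nonneg q)

theorem lintegral_bumpRegression_flip_le {d q : ℕ} (hd : 1 ≤ d) (hq : 1 ≤ q) {a b : ℝ} (h : ℝ)
    (ha : 0 ≤ a) (hb : 0 ≤ b) (σ : (Fin d → Fin q) → Bool) (k : Fin d → Fin q) :
    ∫⁻ x, ENNReal.ofReal ((bumpRegression d q h σ x -
      bumpRegression d q h (Function.update σ k !(σ k)) x) ^ 2) ∂(cellMeasure d q a b)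
      ≤ ENNReal.ofReal (4 * h ^ 2) * cellMeasure d q a b (cell k) := by
  rw [← lintegral_indicator_const (measurableSet_cell k)]
  refine lintegral_mono_ae ?_
  filter_upwards [ae_mem_cells_or_reservoir (q := q) ha hb] with x hx
  rcases hx with ⟨l, hl⟩ | hx
  · rw [bumpRegression_of_mem_cell hq h _ l hl, bumpRegression_of_mem_cell hq h _ l hl]
    by_cases hlk : l = k
    · subst hlk
      rw [Set.indicator_of_mem hl]
      refine ENNReal.ofReal_le_ofReal (le_of_eq ?_)
      cases hσ : σ l <;> simp <;> ring
    · simp [Function.update_of_ne hlk]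
  · simp [bumpRegression_of_mem_reservoir hd hq h _ hx]

theorem exists_grid_size {D : ℝ} (hD : 0 < D) {n : ℕ} (hn : 1 ≤ n) :
    ∃ q : ℕ, 1 ≤ q ∧ (n : ℝ) ≤ (q : ℝ) ^ D ∧ (q : ℝ) ≤ 2 * (n : ℝ) ^ D⁻¹ := by
  have hn1 : (1 : ℝ) ≤ n := by exact_mod_cast hn
  have hp1 : (1 : ℝ) ≤ (n : ℝ) ^ D⁻¹ := Real.one_le_rpow hn1 (by positivity)
  refine ⟨⌈(n : ℝ) ^ D⁻¹⌉₊, Nat.one_le_ceil_iff.2 (by linarith), ?_, ?_⟩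
  · calc (n : ℝ) = ((n : ℝ) ^ D⁻¹) ^ D := by
          rw [← Real.rpow_mul (by positivity), inv_mul_cancel₀ hD.ne', Real.rpow_one]
      _ ≤ _ := by
          gcongr
          exact Nat.le_ceil _
  · linarith [Nat.ceil_lt_add_one (show 0 ≤ (n : ℝ) ^ D⁻¹ by linarith)]

theorem statement4 (d : ℕ) (hd : 1 ≤ d) (L β α : ℝ) (hL : 0 < L) (hβ : 0 < β)
    (hα : 0 < α) :
    ∃ (C₀ c₀ r₀ μmax : ℝ) (𝒞 : Set (Euc d)),
      0 < C₀ ∧ 0 < c₀ ∧ 0 < r₀ ∧ 1 < μmax ∧ IsCompact 𝒞 ∧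
      {x : Euc d | ∀ i, x i ∈ Set.Icc (0:ℝ) 1} ⊆ 𝒞 ∧
      ∃ C > (0:ℝ), ∀ n : ℕ, 1 ≤ n → ∀ fhat : (Fin n → Euc d × ℝ) → Euc d → Bool,
        Measurable (Function.uncurry fhat) →
        ∃ (PX : Measure (Euc d)) (η : Euc d → ℝ),
          IsProbabilityMeasure PX ∧ Measurable η ∧ (∀ x, η x ∈ Set.Icc (0:ℝ) 1) ∧
          margin d α C₀ PX η ∧ η ∈ holderClass d β L ∧
          mildDensity d c₀ r₀ μmax 𝒞 PX ∧
          C * (n : ℝ) ^ (-((1 + α) * β / ((2 + α) * β + d))) ≤ expectedExcess d n PX η fhat := by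

  obtain ⟨M, hM, hbump⟩ := exists_mem_holderClass_of_hasCompactSupport hβ
    (stdBump d).contDiff (stdBump d).hasCompactSupport
  set V : ℝ := volume.real (Metric.closedBall (0 : Euc d) (1 / 4)) with hVdef
  have hV : 0 < V := ENNReal.toReal_pos
    (Metric.measure_closedBall_pos _ _ (by norm_num)).ne' measure_closedBall_lt_top.ne
  set c : ℝ := min (1 / 5) (L / (2 * M)) with hcdef
  have hc : 0 < c := lt_min (by norm_num) (by positivity)
  have hc5 : c ≤ 1 / 5 := min_le_left _ _
  have hcL : 2 * M * c ≤ L := by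
    have := min_le_right (1 / 5) (L / (2 * M))
    rw [← hcdef, le_div_iff₀ (by positivity)] at this
    linarith
  have hd0 : (0 : ℝ) < d := by exact_mod_cast hd
  set D : ℝ := (2 + α) * β + d with hDdef
  have hD : 0 < D := by positivity
  have hV1 : V / (1 + V) ≤ 1 := by rw [div_le_one (by positivity)]; linarith
  refine ⟨c ^ (-α), (1 / 2) ^ d, 1, 2 + 1 / V, Metric.closedBall 0 (d + 2), by positivity,
    by positivity, one_pos, by linarith [one_div_pos.2 hV], isCompact_closedBall _ _,
    fun x hx => ?_, c * (V / (1 + V)) / 16 * 2 ^ (-((1 + α) * β)), by positivity,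
    fun n hn fhat hfhat => ?_⟩
  · rw [mem_closedBall_zero_iff]
    have := norm_le_card_of_abs_le_one fun i => abs_le.2 ⟨by linarith [(hx i).1], (hx i).2⟩
    linarith
  obtain ⟨q, hq, hnq, hqn⟩ := exists_grid_size hD hn
  have hQ1 : (1 : ℝ) ≤ q := by exact_mod_cast hq
  have hQ : (0 : ℝ) < q := by linarith
  set h : ℝ := c * (q : ℝ) ^ (-β) with hhdef
  have hh : 0 < h := by positivity
  have hhc : h ≤ c := mul_le_of_le_one_right hc.le
    (Real.rpow_le_one_of_one_le_of_nonpos hQ1 (by linarith))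
  set a : ℝ := (q : ℝ) ^ (-(α * β)) / (1 + V) with hadef
  have ha : 0 ≤ a := by positivity
  have hqa : (q : ℝ) ^ (-(α * β)) ≤ 1 :=
    Real.rpow_le_one_of_one_le_of_nonpos hQ1 (by linarith [mul_pos hα hβ])
  have ha1 : a ≤ 1 := div_le_one_of_le₀ (by linarith) (by positivity)
  have haV : a * V = (V / (1 + V)) * (q : ℝ) ^ (-(α * β)) := by rw [hadef]; ring
  have haV1 : a * V ≤ 1 := haV ▸ mul_le_one₀ hV1 (by positivity) hqa
  set b : ℝ := (1 - a * V) / V with hbdef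
  have hb : 0 ≤ b := div_nonneg (by linarith) hV.le
  have hb1 : b ≤ 1 / V := by
    rw [hbdef]
    gcongr
    linarith [mul_nonneg ha hV.le]
  have hab : (a + b) * V = 1 := by rw [hbdef]; field_simp; ring
  set w : ℝ := a * ((q : ℝ)⁻¹ ^ d * V) with hwdef
  have hw : w = (V / (1 + V)) * ((q : ℝ) ^ (-(α * β)) * (q : ℝ) ^ (-(d : ℝ))) := by
    rw [hwdef, Real.rpow_neg hQ.le d, Real.rpow_natCast, inv_pow]
    linear_combination ((q : ℝ) ^ d)⁻¹ * haV
  have hprob := isProbabilityMeasure_cellMeasure hd hq ha hb hab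
  have hrange : ∀ σ x, bumpRegression d q h σ x ∈ Set.Icc (1 / 4 : ℝ) (3 / 4) := by
    intro σ x
    have := abs_le.1 (abs_bumpRegression_sub_half_le hh.le σ x)
    constructor <;> linarith [this.1, this.2]
  have hcell (k : Fin d → Fin q) : cellMeasure d q a b (cell k) = ENNReal.ofReal w :=
    cellMeasure_cell hd hq ha hb k
  have hδ (σ : (Fin d → Fin q) → Bool) (k : Fin d → Fin q) :
      ∫⁻ x, ENNReal.ofReal ((bumpRegression d q h σ x -
        bumpRegression d q h (Function.update σ k !(σ k)) x) ^ 2) ∂(cellMeasure d q a b)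
        ≤ ENNReal.ofReal (4 * h ^ 2 * w) := by
    rw [ENNReal.ofReal_mul (by positivity), ← hcell k]
    exact lintegral_bumpRegression_flip_le hd hq h ha hb σ k
  have hnδ : n * (4 * h ^ 2 * w) ≤ 3 / 16 := by
    have e : 4 * h ^ 2 * w = 4 * c ^ 2 * (V / (1 + V)) * (q : ℝ) ^ (-D) := by
      have e' : (q : ℝ) ^ (-D) = ((q : ℝ) ^ (-β)) ^ 2 *
          ((q : ℝ) ^ (-(α * β)) * (q : ℝ) ^ (-(d : ℝ))) := by
        rw [← Real.rpow_natCast, ← Real.rpow_mul hQ.le, ← Real.rpow_add hQ, ← Real.rpow_add hQ]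
        congr 1
        push_cast
        ring
      rw [e', hw, hhdef]
      ring
    have h1 : n * (q : ℝ) ^ (-D) ≤ 1 := by
      rw [Real.rpow_neg hQ.le, ← div_eq_mul_inv]
      exact div_le_one_of_le₀ hnq (by positivity)
    calc n * (4 * h ^ 2 * w) = 4 * c ^ 2 * (V / (1 + V)) * (n * (q : ℝ) ^ (-D)) := by rw [e]; ring
      _ ≤ 4 * (1 / 5) ^ 2 * 1 * 1 := by gcongr
      _ ≤ 3 / 16 := by norm_num
  obtain ⟨σ, hσ⟩ := exists_expectedExcess_ge (cellMeasure d q a b)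
    (fun σ => (continuous_bumpRegression d q h σ).measurable) hrange measurableSet_cell
    (disjoint_cell hq) hh (fun σ k x hx => bumpRegression_of_mem_cell hq h σ k hx)
    (fun k => by rw [Measure.real, hcell k, ENNReal.toReal_ofReal (by positivity)])
    (δ := 4 * h ^ 2 * w) (by positivity) (fun σ k => by convert hδ σ k) hnδ hfhat
  refine ⟨cellMeasure d q a b, bumpRegression d q h σ, hprob,
    (continuous_bumpRegression d q h σ).measurable,
    fun x => Set.Icc_subset_Icc (by norm_num) (by norm_num) (hrange σ x),
    margin_bumpRegression hd hq ha hb hh hα (by positivity) ?_ σ,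
    holderClass_mono ?_ (bumpRegression_mem_holderClass hM.le hh.le hbump σ),
    mildDensity_cellMeasure hq ha hb (by linarith), le_trans ?_ hσ⟩
  · have e : c ^ (-α) * h ^ α = (q : ℝ) ^ (-(α * β)) := by
      rw [hhdef, Real.mul_rpow hc.le (by positivity), ← mul_assoc, ← Real.rpow_add hc,
        neg_add_cancel, Real.rpow_zero, one_mul, ← Real.rpow_mul hQ.le]
      congr 1
      ring
    rw [e, haV]
    exact mul_le_of_le_one_left (by positivity) hV1
  · have e : h * (q : ℝ) ^ β = c := by
      rw [hhdef, mul_assoc, ← Real.rpow_add hQ, neg_add_cancel, Real.rpow_zero, mul_one]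
    rw [mul_assoc _ h, e]
    exact hcL
  · have e : (Fintype.card (Fin d → Fin q) : ℝ) * (h * w / 16)
        = c * (V / (1 + V)) / 16 * (q : ℝ) ^ (-((1 + α) * β)) := by
      have e' : (q : ℝ) ^ (-((1 + α) * β)) = (q : ℝ) ^ (-β) * (q : ℝ) ^ (-(α * β)) := by
        rw [← Real.rpow_add hQ]
        congr 1
        ring
      have hd' : (q : ℝ) ^ d * (q : ℝ) ^ (-(d : ℝ)) = 1 := by
        rw [Real.rpow_neg hQ.le, Real.rpow_natCast, mul_inv_cancel₀ (by positivity)]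
      rw [e', hw, hhdef]
      simp only [Fintype.card_pi, Fintype.card_fin, Finset.prod_const, Finset.card_univ,
        Nat.cast_pow]
      linear_combination (c * (q : ℝ) ^ (-β) * (V / (1 + V)) * (q : ℝ) ^ (-(α * β)) / 16) * hd'
    rw [e, mul_assoc]
    refine mul_le_mul_of_nonneg_left ?_ (by positivity)
    have e2 : (n : ℝ) ^ (-((1 + α) * β / D)) = ((n : ℝ) ^ D⁻¹) ^ (-((1 + α) * β)) := by
      rw [← Real.rpow_mul (by positivity)]
      congr 1
      ring
    rw [e2, ← Real.mul_rpow (by norm_num) (by positivity)]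
    exact Real.rpow_le_rpow_of_nonpos hQ hqn (neg_nonpos.2 (by positivity))
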